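/- Let T ⊆ M, let Q be a set of monoid projections on M, and let I be a radical order ideal of M. For f ∈ T set Q(f;I) = {Q ∈ Q : Q(f) ∉ I}. If the family {Q(f;I) : f ∈ T} covers Q (i.e. every Q ∈ Q satisfies Q(f) ∉ I for some f ∈ T), then there exists T' ⊆ T with card T' < κ(Q[T], I) such that the family {Q(f;I) : f ∈ T'} still covers Q. -/

import Mathlib

open Cardinal

/-- A positively ordered (p.o.) monoid. -/
class POMonoid (M : Type*) extends CommMonoid M, PartialOrder M, OrderBot M where
  le_one : ∀ f : M, f ≤ 1
  mul_le_mul_of_le : ∀ {f g : M}, f ≤ g → ∀ h : M, f * h ≤ g * h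

/-- An order ideal: downward closed set. -/
def IsOrderIdeal {M : Type*} [POMonoid M] (I : Set M) : Prop :=
  ∀ f ∈ I, ∀ g : M, g ≤ f → g ∈ I

/-- A radical set: `f ∈ I` whenever `f ^ n ∈ I` for some `n ≥ 1`. -/
def IsRadicalSet {M : Type*} [POMonoid M] (I : Set M) : Prop :=
  ∀ f : M, ∀ n : ℕ, 1 ≤ n → f ^ n ∈ I → f ∈ I

/-- `D` is mutually `I`-disjoint. -/
def MutuallyDisjointMod {M : Type*} [POMonoid M] (I D : Set M) : Prop :=
  D ∩ I = ∅ ∧ ∀ f ∈ D, ∀ g ∈ D, f ≠ g → f * g ∈ I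

/-- `κ(T, I)`. -/
noncomputable def kappa {M : Type*} [POMonoid M] (T I : Set M) : Cardinal :=
  sInf {c : Cardinal | ∀ D : Set M, D ⊆ T → MutuallyDisjointMod I D → #D < c}

/-- A monoid projection. -/
def IsMonoidProjection {M : Type*} [POMonoid M] (Q : M → M) : Prop :=
  Monotone Q ∧ (∀ f : M, Q f ≤ f) ∧ ∀ f g : M, f * Q g ≤ Q (f * g)

/-- `𝒬[T]`. -/
def projImage {M : Type*} [POMonoid M] (𝒬 : Set (M → M)) (T : Set M) : Set M :=
  {h : M | ∃ Q ∈ 𝒬, ∃ f ∈ T, Q f = h}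

section Helpers

variable {M : Type*} [POMonoid M]

/-- The cardinality of a mutually `I`-disjoint subset of `T` is below `κ(T, I)`. -/
theorem MutuallyDisjointMod.mk_lt_kappa {T I D : Set M} (hDT : D ⊆ T)
    (hD : MutuallyDisjointMod I D) : #D < kappa T I := by
  have hne : {c : Cardinal | ∀ D : Set M, D ⊆ T → MutuallyDisjointMod I D → #D < c}.Nonempty :=
    ⟨Order.succ #M, fun D _ _ => Order.lt_succ_of_le (mk_set_le D)⟩
  exact csInf_mem hne D hDT hD

/-- Every set has a maximal mutually `I`-disjoint subset. -/
theorem exists_maximal_mutuallyDisjointMod (T I : Set M) :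
    ∃ D, Maximal (fun D : Set M => D ⊆ T ∧ MutuallyDisjointMod I D) D := by
  refine zorn_subset {D : Set M | D ⊆ T ∧ MutuallyDisjointMod I D} fun c hc hchain =>
    ⟨⋃₀ c, ⟨Set.sUnion_subset fun D hD => (hc hD).1, ?_, ?_⟩,
      fun D hD => Set.subset_sUnion_of_mem hD⟩
  · ext x
    simp only [Set.mem_inter_iff, Set.mem_sUnion, Set.mem_empty_iff_false, iff_false]
    rintro ⟨⟨D, hD, hxD⟩, hxI⟩
    exact Set.eq_empty_iff_forall_notMem.mp (hc hD).2.1 x ⟨hxD, hxI⟩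
  · rintro f ⟨D, hD, hf⟩ g ⟨E, hE, hg⟩ hfg
    rcases hchain.total hD hE with h | h
    · exact (hc hE).2.2 f (h hf) g hg hfg
    · exact (hc hD).2.2 f hf g (h hg) hfg

theorem IsMonoidProjection.mul_le {P Q : M → M} (hP : IsMonoidProjection P)
    (hQ : IsMonoidProjection Q) (f g : M) : P f * Q g ≤ Q f :=
  calc P f * Q g ≤ f * Q g := POMonoid.mul_le_mul_of_le (hP.2.1 f) _
    _ ≤ Q (f * g) := hQ.2.2 f g
    _ ≤ Q f := hQ.1 <| by
      simpa only [mul_comm g f, one_mul] using POMonoid.mul_le_mul_of_le (POMonoid.le_one g) f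

end Helpers

/-- Compactness: if the sets `𝒬(f; I)`, `f ∈ T`, cover `𝒬`, then some
subfamily indexed by a subset of `T` of cardinality `< κ(𝒬[T], I)` already
covers `𝒬`. -/
theorem stmt12 {M : Type*} [POMonoid M] (T : Set M) (𝒬 : Set (M → M))
    (h𝒬 : ∀ Q ∈ 𝒬, IsMonoidProjection Q) (I : Set M)
    (hord : IsOrderIdeal I) (hrad : IsRadicalSet I)
    (hcover : ∀ Q ∈ 𝒬, ∃ f ∈ T, Q f ∉ I) :
    ∃ T' : Set M, T' ⊆ T ∧ #T' < kappa (projImage 𝒬 T) I ∧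
      ∀ Q ∈ 𝒬, ∃ f ∈ T', Q f ∉ I := by
  obtain ⟨D, ⟨hDT, hD⟩, hmax⟩ := exists_maximal_mutuallyDisjointMod (projImage 𝒬 T) I
  choose P hP φ hφ hPφ using fun d : D => hDT d.2
  refine ⟨Set.range φ, Set.range_subset_iff.mpr hφ,
    mk_range_le.trans_lt (hD.mk_lt_kappa hDT), fun Q hQ => ?_⟩
  by_contra! huncovered
  obtain ⟨f, hfT, hf⟩ := hcover Q hQ
  have hmul : ∀ d ∈ D, d * Q f ∈ I := fun d hd => by
    have hle := (h𝒬 _ (hP ⟨d, hd⟩)).mul_le (h𝒬 Q hQ) (φ ⟨d, hd⟩) f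
    rw [hPφ] at hle
    exact hord _ (huncovered _ (Set.mem_range_self _)) _ hle
  have hinsert : MutuallyDisjointMod I (insert (Q f) D) := by
    refine ⟨by rw [Set.insert_inter_of_notMem hf, hD.1], ?_⟩
    rintro a (rfl | ha) b (rfl | hb) hab
    · exact absurd rfl hab
    · exact mul_comm b (Q f) ▸ hmul b hb
    · exact hmul a ha
    · exact hD.2 a ha b hb hab
  have hmem : Q f ∈ D :=
    hmax ⟨Set.insert_subset ⟨Q, hQ, f, hfT, rfl⟩ hDT, hinsert⟩ (Set.subset_insert _ _)
      (Set.mem_insert _ _)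
  exact hf (hrad _ 2 one_le_two (by rw [pow_two]; exact hmul _ hmem))
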